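/- Assume (A1), take α = 1, and suppose min_{x∈ℝ} f(x)g(x) > n − 1. Then there exist ε₀ > 0 and c₀ > 0 such that for every ε ∈ (0, ε₀), every positive classical solution u of the scaled problem on ℝ × [0,T) satisfies u(x,t) ≥ ε c₀ for all (x,t) ∈ ℝ × [0,T); in particular quenching does not happen for ε ∈ (0, ε₀). -/

import Mathlib

open Real Set Filter Topology

noncomputable section

/-- Partial derivative in the space variable `x`. -/
def pdx (u : ℝ → ℝ → ℝ) (x t : ℝ) : ℝ := deriv (fun y => u y t) x

/-- Second partial derivative in the space variable `x`. -/
def pdxx (u : ℝ → ℝ → ℝ) (x t : ℝ) : ℝ := deriv (fun y => pdx u y t) x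

/-- Partial derivative in the time variable `t`. -/
def pdt (u : ℝ → ℝ → ℝ) (x t : ℝ) : ℝ := deriv (fun s => u x s) t

/-- Assumption (A1): `f` is `C¹`, `ℤ`-periodic and positive; `g` is `C²`, `ℤ`-periodic
and positive. -/
def A1 (f g : ℝ → ℝ) : Prop :=
  ContDiff ℝ 1 f ∧ (∀ x, f (x + 1) = f x) ∧ (∀ x, 0 < f x) ∧
  ContDiff ℝ 2 g ∧ (∀ x, g (x + 1) = g x) ∧ (∀ x, 0 < g x)

/-- A positive classical solution of the scaled problem on `ℝ × [0, T)`, where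
`T : EReal` with `0 < T ≤ ∞`:
`u_t = u_xx/((u_x)² + 1) − (n−1)/u + (1/ε) f(x) √((u_x)² + 1)`, `u(x,0) = ε^α g(x)`. -/
structure IsSol (n : ℕ) (f g : ℝ → ℝ) (ε α : ℝ) (T : EReal) (u : ℝ → ℝ → ℝ) : Prop where
  pos : ∀ x t : ℝ, 0 ≤ t → (t : EReal) < T → 0 < u x t
  cont : ContinuousOn (fun p : ℝ × ℝ => u p.1 p.2)
    {p : ℝ × ℝ | 0 ≤ p.2 ∧ (p.2 : EReal) < T}
  smooth : ContDiffOn ℝ (⊤ : ℕ∞) (fun p : ℝ × ℝ => u p.1 p.2)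
    {p : ℝ × ℝ | 0 < p.2 ∧ (p.2 : EReal) < T}
  periodic : ∀ x t : ℝ, u (x + 1) t = u x t
  eqn : ∀ x t : ℝ, 0 < t → (t : EReal) < T →
    pdt u x t = pdxx u x t / ((pdx u x t) ^ 2 + 1) - ((n : ℝ) - 1) / u x t
      + (1 / ε) * f x * Real.sqrt ((pdx u x t) ^ 2 + 1)
  init : ∀ x : ℝ, u x 0 = ε ^ α * g x

/-- The second derivative of a function at a local minimum is nonnegative. -/
theorem deriv_deriv_nonneg_of_isLocalMin {φ : ℝ → ℝ} {x : ℝ} (h : IsLocalMin φ x)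
    (hc : ContinuousAt φ x) : 0 ≤ deriv (deriv φ) x := by
  by_contra! hneg
  have hmax := isLocalMax_of_deriv_deriv_neg hneg h.deriv_eq_zero hc
  have hconst : φ =ᶠ[𝓝 x] fun _ => φ x := by
    filter_upwards [h, hmax] with y h₁ h₂ using le_antisymm h₂ h₁
  have hzero : deriv (deriv φ) x = 0 := by
    rw [hconst.deriv.deriv_eq]
    simp
  exact hneg.ne hzero

/-- The derivative is nonpositive at a point whose left neighbours take larger values. -/
theorem deriv_nonpos_of_eventually_le_left {φ : ℝ → ℝ} {t : ℝ} (hd : DifferentiableAt ℝ φ t)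
    (h : ∀ᶠ s in 𝓝[<] t, φ t ≤ φ s) : deriv φ t ≤ 0 := by
  have hlim : Tendsto (slope φ t) (𝓝[<] t) (𝓝 (deriv φ t)) :=
    hd.hasDerivAt.tendsto_slope.mono_left (nhdsWithin_mono t fun s hs => ne_of_lt hs)
  refine le_of_tendsto hlim ?_
  filter_upwards [h, self_mem_nhdsWithin] with s hs hst
  rw [slope_def_field]
  exact div_nonpos_of_nonneg_of_nonpos (sub_nonneg.2 hs) (sub_nonpos.2 (le_of_lt hst))

/-- If a spatially periodic function starts strictly above a stationary barrier and falls below it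
later, then there is a first time at which it touches the barrier. -/
theorem exists_first_touching {u : ℝ → ℝ → ℝ} {w : ℝ → ℝ} {x₁ t₁ : ℝ} (ht₁ : 0 ≤ t₁)
    (hu : ContinuousOn (fun p : ℝ × ℝ => u p.1 p.2) (univ ×ˢ Icc 0 t₁))
    (hup : ∀ t, Function.Periodic (fun x => u x t) 1)
    (hw : Continuous w) (hwp : Function.Periodic w 1)
    (hinit : ∀ x, w x < u x 0) (hbelow : u x₁ t₁ ≤ w x₁) :
    ∃ x₀, ∃ t₀ ∈ Ioc 0 t₁, u x₀ t₀ = w x₀ ∧ (∀ x, w x ≤ u x t₀) ∧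
      ∀ t ∈ Ico 0 t₀, w x₀ < u x₀ t := by
  have hper : ∀ x, ∃ y ∈ Icc (0 : ℝ) 1, ∀ t, u x t - w x = u y t - w y := by
    intro x
    refine ⟨Int.fract x, ⟨Int.fract_nonneg x, (Int.fract_lt_one x).le⟩, fun t => ?_⟩
    have h₁ := (hup t).sub_zsmul_eq (x := x) ⌊x⌋
    have h₂ := hwp.sub_zsmul_eq (x := x) ⌊x⌋
    simp only [zsmul_one, Int.self_sub_floor] at h₁ h₂
    rw [h₁, h₂]
  have hcont : ContinuousOn (fun p : ℝ × ℝ => u p.1 p.2 - w p.1) (Icc 0 1 ×ˢ Icc 0 t₁) :=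
    (hu.mono (prod_mono (subset_univ _) Subset.rfl)).sub (hw.comp continuous_fst).continuousOn
  have hK : IsCompact ((Icc (0 : ℝ) 1 ×ˢ Icc 0 t₁) ∩
      (fun p : ℝ × ℝ => u p.1 p.2 - w p.1) ⁻¹' Iic 0) :=
    (isCompact_Icc.prod isCompact_Icc).of_isClosed_subset
      (hcont.preimage_isClosed_of_isClosed (isClosed_Icc.prod isClosed_Icc) isClosed_Iic)
      inter_subset_left
  obtain ⟨y₁, hy₁, hyu⟩ := hper x₁
  obtain ⟨⟨x₀, t₀⟩, ⟨⟨hx₀, ht₀⟩, htouch⟩, hmin⟩ := hK.exists_isMinOn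
    ⟨(y₁, t₁), ⟨hy₁, ht₁, le_rfl⟩, by
      simpa [← hyu t₁] using hbelow⟩ continuous_snd.continuousOn
  simp only [mem_preimage, mem_Iic] at htouch hx₀ ht₀
  have hbefore : ∀ x, ∀ t ∈ Ico 0 t₀, w x < u x t := by
    intro x t ht
    obtain ⟨y, hy, hyt⟩ := hper x
    by_contra! hle
    have : t₀ ≤ t := hmin (a := (y, t)) ⟨⟨hy, ht.1, ht.2.le.trans ht₀.2⟩, by
      simp only [mem_preimage, mem_Iic, ← hyt t]
      linarith⟩
    exact absurd ht.2 this.not_gt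
  have hpos : 0 < t₀ := by
    refine lt_of_le_of_ne ht₀.1 fun h => ?_
    subst h
    linarith [hinit x₀]
  have habove : ∀ x, w x ≤ u x t₀ := by
    intro x
    have hct : ContinuousWithinAt (fun t => u x t) (Icc 0 t₁) t₀ :=
      (hu.comp (f := fun t => (x, t)) (by fun_prop) fun t ht => ⟨mem_univ _, ht⟩) t₀ ht₀
    have hmem : Icc 0 t₁ ∈ 𝓝[<] t₀ :=
      mem_of_superset (Ioo_mem_nhdsLT hpos) fun t ht => ⟨ht.1.le, ht.2.le.trans ht₀.2⟩
    have hlim : Tendsto (fun t => u x t) (𝓝[<] t₀) (𝓝 (u x t₀)) :=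
      hct.mono_left (nhdsWithin_le_iff.2 hmem)
    refine ge_of_tendsto hlim ?_
    filter_upwards [Ioo_mem_nhdsLT hpos] with t ht using (hbefore x t ⟨ht.1.le, ht.2⟩).le
  exact ⟨x₀, t₀, ⟨hpos, ht₀.2⟩, le_antisymm (by linarith) (habove x₀), habove, hbefore x₀⟩

namespace IsSol

variable {n : ℕ} {f g : ℝ → ℝ} {ε α : ℝ} {T : EReal} {u : ℝ → ℝ → ℝ}

theorem contDiffAt (hu : IsSol n f g ε α T u) (x : ℝ) {t : ℝ} (ht : 0 < t)
    (htT : (t : EReal) < T) :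
    ContDiffAt ℝ (⊤ : ℕ∞) (fun p : ℝ × ℝ => u p.1 p.2) (x, t) := by
  refine hu.smooth.contDiffAt (IsOpen.mem_nhds ?_ ⟨ht, htT⟩)
  exact (isOpen_lt continuous_const continuous_snd).inter
    (isOpen_lt (continuous_coe_real_ereal.comp continuous_snd) continuous_const)

theorem contDiff_space (hu : IsSol n f g ε α T u) {t : ℝ} (ht : 0 < t) (htT : (t : EReal) < T) :
    ContDiff ℝ 2 (fun x => u x t) := by
  refine contDiff_iff_contDiffAt.2 fun x => ?_
  exact ((hu.contDiffAt x ht htT).of_le (by norm_cast)).comp x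
    (f := fun y => (y, t)) (by fun_prop)

theorem differentiableAt_time (hu : IsSol n f g ε α T u) (x : ℝ) {t : ℝ} (ht : 0 < t)
    (htT : (t : EReal) < T) : DifferentiableAt ℝ (fun s => u x s) t :=
  ((hu.contDiffAt x ht htT).differentiableAt (by simp)).comp t
    (f := fun s => (x, s)) (by fun_prop)

/-- A periodic stationary strict subsolution lying below the initial data stays below the
solution. -/
theorem barrier_le (hu : IsSol n f g ε α T u) {w : ℝ → ℝ} (hw : ContDiff ℝ 2 w)
    (hwp : Function.Periodic w 1) (hinit : ∀ x, w x < u x 0)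
    (hsub : ∀ x, 0 < deriv (deriv w) x / ((deriv w x) ^ 2 + 1) - ((n : ℝ) - 1) / w x
      + (1 / ε) * f x * Real.sqrt ((deriv w x) ^ 2 + 1))
    (x t : ℝ) (ht : 0 ≤ t) (htT : (t : EReal) < T) : w x ≤ u x t := by
  by_contra! hlt
  have hlife : ∀ s ≤ t, (s : EReal) < T := fun s hs => (EReal.coe_le_coe hs).trans_lt htT
  obtain ⟨x₀, t₀, ht₀, htouch, habove, hbefore⟩ := exists_first_touching ht
    (hu.cont.mono fun p hp => ⟨hp.2.1, hlife _ hp.2.2⟩) (fun s y => hu.periodic y s)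
    hw.continuous hwp hinit hlt.le
  have ht₀T := hlife t₀ ht₀.2
  have hc := hu.contDiff_space ht₀.1 ht₀T
  have hud : Differentiable ℝ (fun y => u y t₀) := hc.differentiable (by norm_num)
  have hwd : Differentiable ℝ w := hw.differentiable (by norm_num)
  have hderiv : deriv (fun y => u y t₀ - w y) = fun y => pdx u y t₀ - deriv w y := by
    ext y
    exact deriv_fun_sub (hud y) (hwd y)
  have hmin : IsLocalMin (fun y => u y t₀ - w y) x₀ :=
    Eventually.of_forall fun y => by simpa [htouch] using habove y
  have hx : pdx u x₀ t₀ = deriv w x₀ := by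
    have := hmin.deriv_eq_zero
    rw [hderiv] at this
    linarith
  have hxx : deriv (deriv w) x₀ ≤ pdxx u x₀ t₀ := by
    have h := deriv_deriv_nonneg_of_isLocalMin hmin (hud.sub hwd x₀).continuousAt
    have hpd : DifferentiableAt ℝ (fun y => pdx u y t₀) x₀ := hc.differentiable_deriv_two x₀
    rw [hderiv, deriv_fun_sub hpd (hw.differentiable_deriv_two x₀)] at h
    exact sub_nonneg.1 h
  have htime : pdt u x₀ t₀ ≤ 0 := by
    refine deriv_nonpos_of_eventually_le_left (hu.differentiableAt_time x₀ ht₀.1 ht₀T) ?_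
    filter_upwards [Ioo_mem_nhdsLT ht₀.1] with s hs
    exact htouch.trans_le (hbefore s ⟨hs.1.le, hs.2⟩).le
  rw [hu.eqn x₀ t₀ ht₀.1 ht₀T, hx, htouch] at htime
  have hdiv : deriv (deriv w) x₀ / ((deriv w x₀) ^ 2 + 1) ≤
      pdxx u x₀ t₀ / ((deriv w x₀) ^ 2 + 1) := by gcongr
  linarith [hsub x₀]

end IsSol

/-- A continuous periodic function is bounded. -/
theorem exists_pos_abs_le_of_periodic {h : ℝ → ℝ} (hp : Function.Periodic h 1)
    (hc : Continuous h) : ∃ M, 0 < M ∧ ∀ x, |h x| ≤ M := by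
  obtain ⟨M, hM, hb⟩ := (hp.isBounded_of_continuous one_ne_zero hc).exists_pos_norm_le
  exact ⟨M, hM, fun x => hb _ (mem_range_self x)⟩

/-- A positive continuous periodic function is bounded away from zero. -/
theorem exists_pos_le_of_periodic {h : ℝ → ℝ} (hp : Function.Periodic h 1)
    (hc : Continuous h) (hpos : ∀ x, 0 < h x) : ∃ m, 0 < m ∧ ∀ x, m ≤ h x := by
  obtain ⟨_, ⟨y, rfl⟩, hy⟩ := (hp.compact_of_continuous one_ne_zero hc).exists_isLeast
    (range_nonempty h)
  exact ⟨h y, hpos y, fun x => hy (mem_range_self x)⟩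

/-- Under (A1), for `α = 1`, if `min_{x} f(x)g(x) > n − 1` then there exist
`ε₀ > 0` and `c₀ > 0` such that for every `ε ∈ (0, ε₀)` every positive classical solution
of the scaled problem on `ℝ × [0,T)` satisfies `u(x,t) ≥ ε c₀`; quenching does not happen. -/
theorem no_quenching_critical (n : ℕ) (hn : 2 ≤ n) (f g : ℝ → ℝ) (hA1 : A1 f g)
    (hfg : (n : ℝ) - 1 < sInf (Set.range fun x => f x * g x)) :
    ∃ ε₀ : ℝ, 0 < ε₀ ∧ ∃ c₀ : ℝ, 0 < c₀ ∧ ∀ ε : ℝ, 0 < ε → ε < ε₀ →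
      ∀ T : EReal, 0 < T → ∀ u : ℝ → ℝ → ℝ, IsSol n f g ε 1 T u →
        ∀ x t : ℝ, 0 ≤ t → (t : EReal) < T → ε * c₀ ≤ u x t := by
  obtain ⟨-, -, hf, hg2, hgp, hg⟩ := hA1
  set m := sInf (Set.range fun x => f x * g x)
  have hm : ∀ x, m ≤ f x * g x := fun x => csInf_le
    ⟨0, by rintro _ ⟨y, rfl⟩; exact (mul_pos (hf y) (hg y)).le⟩ (mem_range_self x)
  have hn1 : (1 : ℝ) ≤ (n : ℝ) - 1 := by
    have : (2 : ℝ) ≤ n := by exact_mod_cast hn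
    linarith
  have hm0 : 0 < m := by linarith
  have hgp' : Function.Periodic g 1 := hgp
  have hg''c : Continuous (deriv (deriv g)) := by
    simpa [iteratedDeriv_succ] using hg2.continuous_iteratedDeriv 2 le_rfl
  have hg''p : Function.Periodic (deriv (deriv g)) 1 := by
    have hper : ∀ h : ℝ → ℝ, Function.Periodic h 1 → Function.Periodic (deriv h) 1 := by
      intro h hh x
      rw [← deriv_comp_add_const, show (fun y => h (y + 1)) = h from funext hh]
    exact hper _ (hper g hgp')
  obtain ⟨G, hG, hgG⟩ := exists_pos_abs_le_of_periodic hgp' hg2.continuous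
  obtain ⟨K, hK, hgK⟩ := exists_pos_abs_le_of_periodic hg''p hg''c
  obtain ⟨γ, hγ, hgγ⟩ := exists_pos_le_of_periodic hgp' hg2.continuous hg
  obtain ⟨l, hl₁, hl₂⟩ : ∃ l, ((n : ℝ) - 1) / m < l ∧ l < 1 :=
    exists_between ((div_lt_one hm0).2 hfg)
  have hl0 : 0 < l := lt_trans (by positivity) hl₁
  have hgap : 0 < l * m - ((n : ℝ) - 1) := by
    rw [div_lt_iff₀ hm0] at hl₁
    linarith
  refine ⟨min 1 ((l * m - ((n : ℝ) - 1)) / (l * G * (l * K))), by positivity, l * γ,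
    by positivity, ?_⟩
  intro ε hε hε₀ T hT u hu x t ht htT
  have hε1 : ε < 1 := hε₀.trans_le (min_le_left _ _)
  have hε2 := hε₀.trans_le (min_le_right _ _)
  have hd : deriv (fun y => ε * l * g y) = fun y => ε * l * deriv g y := by
    ext y
    exact deriv_const_mul_field _
  have hdd : deriv (deriv fun y => ε * l * g y) = fun y => ε * l * deriv (deriv g) y := by
    rw [hd]
    ext y
    exact deriv_const_mul_field _
  have hle : ε * l * g x ≤ u x t := by
    refine hu.barrier_le (w := fun y => ε * l * g y) (contDiff_const.mul hg2)
      (fun y => by simp only [hgp y]) (fun y => ?_) (fun y => ?_) x t ht htT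
    · rw [hu.init, Real.rpow_one]
      have := mul_pos hε (hg y)
      nlinarith
    · rw [hdd, hd]
      beta_reduce
      set p := ε * l * deriv g y
      have hgy := hg y
      have hreact : (l * m - ((n : ℝ) - 1)) / (ε * (l * G)) ≤
          1 / ε * f y - ((n : ℝ) - 1) / (ε * l * g y) := by
        have h₁ : 1 / ε * f y - ((n : ℝ) - 1) / (ε * l * g y) =
            (l * (f y * g y) - ((n : ℝ) - 1)) / (ε * (l * g y)) := by
          field_simp
        rw [h₁]
        have h₂ := hm y
        have h₃ : g y ≤ G := (le_abs_self _).trans (hgG y)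
        have h₄ : 0 ≤ l * (f y * g y) - ((n : ℝ) - 1) := by nlinarith
        gcongr
      have hdiff : -(ε * l * K) ≤ ε * l * deriv (deriv g) y / (p ^ 2 + 1) := by
        have h₁ := neg_le_of_abs_le (hgK y)
        rw [le_div_iff₀ (by positivity)]
        have h₂ : 0 < ε * l := by positivity
        nlinarith [mul_le_mul_of_nonneg_left h₁ h₂.le,
          mul_nonneg (mul_pos h₂ hK).le (sq_nonneg p)]
      have hsmall : ε * l * K < (l * m - ((n : ℝ) - 1)) / (ε * (l * G)) := by
        rw [lt_div_iff₀ (by positivity)] at hε2 ⊢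
        nlinarith [mul_pos (mul_pos (mul_pos hl0 hG) (mul_pos hl0 hK)) hε]
      have hgrad : 1 / ε * f y ≤ 1 / ε * f y * Real.sqrt (p ^ 2 + 1) := by
        have hfy := hf y
        refine le_mul_of_one_le_right (by positivity) (Real.one_le_sqrt.2 ?_)
        nlinarith [sq_nonneg p]
      linarith
  calc ε * (l * γ) = ε * l * γ := by ring
    _ ≤ ε * l * g x := by gcongr; exact hgγ x
    _ ≤ u x t := hle
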